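/- Let κ ∈ ℝ, c > 0, and let w : ℝ → (0,∞) be a smooth function. Then, as δ → 0⁺, ( 2·𝔰_κ( ∫₀^δ w(ξ) dξ ) / 𝔰_κ( ∫_{−δ}^{δ} w(ξ) dξ ) )^{1/c} = 1 + ( w'(0)/(2·c·w(0)) )·δ + (1/2)·( κ·w(0)²/c + ((1−c)/c²)·( w'(0)/(2·w(0)) )² )·δ² + O(δ³). -/

import Mathlib

open Set Filter Asymptotics intervalIntegral

/-- The comparison function `𝔰_κ`, the solution of `ψ'' + κψ = 0` with
`ψ(0) = 0`, `ψ'(0) = 1`. -/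
noncomputable def sk (κ s : ℝ) : ℝ :=
  if 0 < κ then Real.sin (Real.sqrt κ * s) / Real.sqrt κ
  else if κ = 0 then s
  else Real.sinh (Real.sqrt |κ| * s) / Real.sqrt |κ|

open Topology in
/-- Integrating a bound `f' = O(xⁿ)` near `0`. -/
theorem isBigO_pow_succ_of_hasDerivAt {f f' : ℝ → ℝ} {n : ℕ}
    (hf : ∀ᶠ x in 𝓝 0, HasDerivAt f (f' x) x) (hf0 : f 0 = 0)
    (hf' : f' =O[𝓝 0] fun x => x ^ n) : f =O[𝓝 0] fun x => x ^ (n + 1) := by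
  obtain ⟨C, hC0, hC⟩ := isBigO_iff'.1 hf'
  obtain ⟨r, hr, hball⟩ := Metric.eventually_nhds_iff_ball.1 (hf.and hC)
  refine isBigO_iff.2 ⟨C, Metric.eventually_nhds_iff_ball.2 ⟨r, hr, fun x hx => ?_⟩⟩
  have hsub : Metric.closedBall (0 : ℝ) ‖x‖ ⊆ Metric.ball 0 r :=
    Metric.closedBall_subset_ball (by simpa using hx)
  have h := (convex_closedBall (0 : ℝ) ‖x‖).norm_image_sub_le_of_norm_hasDerivWithin_le
    (f := f) (f' := f') (C := C * ‖x‖ ^ n) (x := 0) (y := x)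
    (fun y hy => (hball y (hsub hy)).1.hasDerivWithinAt)
    (fun y hy => (hball y (hsub hy)).2.trans ?_) (by simp) (by simp)
  · simpa [hf0, pow_succ, mul_assoc] using h
  · rw [norm_pow]
    have : ‖y‖ ≤ ‖x‖ := by simpa using hy
    gcongr

open Topology in
theorem isBigO_pow_of_le {m n : ℕ} (h : m ≤ n) :
    (fun x : ℝ => x ^ n) =O[𝓝 0] fun x => x ^ m := by
  rcases h.eq_or_lt with rfl | h
  · exact isBigO_refl _ _
  · exact (isLittleO_pow_pow h).isBigO

theorem sk_zero (κ : ℝ) : sk κ 0 = 0 := by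
  unfold sk
  split_ifs <;> simp

/-- `𝔰_κ` solves `ψ'' + κψ = 0` with `ψ'(0) = 1`. -/
theorem exists_hasDerivAt_sk (κ : ℝ) : ∃ g : ℝ → ℝ, g 0 = 1 ∧
    (∀ x, HasDerivAt (sk κ) (g x) x) ∧ ∀ x, HasDerivAt g (-κ * sk κ x) x := by
  rcases lt_trichotomy 0 κ with h | rfl | h
  · have hs : √κ ≠ 0 := (Real.sqrt_pos.2 h).ne'
    have hsk : sk κ = fun s => Real.sin (√κ * s) / √κ := by
      funext s
      simp [sk, h]
    refine ⟨fun x => Real.cos (√κ * x), by simp, fun x => ?_, fun x => ?_⟩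
    · rw [hsk]
      refine HasDerivAt.congr_deriv (((hasDerivAt_id x).const_mul √κ).sin.div_const √κ) ?_
      simp [hs]
    · rw [hsk]
      refine HasDerivAt.congr_deriv (((hasDerivAt_id x).const_mul √κ).cos) ?_
      have := Real.mul_self_sqrt h.le
      simp only [id]
      field_simp
      linear_combination -Real.sin (√κ * x) * this
  · have hsk : sk 0 = fun s => s := by
      funext s
      simp [sk]
    refine ⟨fun _ => 1, rfl, fun x => ?_, fun x => ?_⟩
    · rw [hsk]
      exact hasDerivAt_id x
    · simpa using hasDerivAt_const x (1 : ℝ)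
  · have hs : √|κ| ≠ 0 := (Real.sqrt_pos.2 (abs_pos.2 h.ne)).ne'
    have hsk : sk κ = fun s => Real.sinh (√|κ| * s) / √|κ| := by
      funext s
      simp [sk, h.not_gt, h.ne]
    refine ⟨fun x => Real.cosh (√|κ| * x), by simp, fun x => ?_, fun x => ?_⟩
    · rw [hsk]
      refine HasDerivAt.congr_deriv (((hasDerivAt_id x).const_mul √|κ|).sinh.div_const √|κ|) ?_
      simp [hs]
    · rw [hsk]
      refine HasDerivAt.congr_deriv (((hasDerivAt_id x).const_mul √|κ|).cosh) ?_
      have := Real.mul_self_sqrt (abs_nonneg κ)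
      rw [abs_of_neg h] at hs this ⊢
      simp only [id]
      field_simp
      linear_combination Real.sinh (√(-κ) * x) * this

open Topology in
theorem sk_sub_isBigO (κ : ℝ) :
    (fun x => sk κ x - (x - κ / 6 * x ^ 3)) =O[𝓝 0] fun x => x ^ 4 := by
  obtain ⟨g, hg0, hs, hg⟩ := exists_hasDerivAt_sk κ
  have sk_O : sk κ =O[𝓝 0] fun x => x ^ 1 := by
    simpa [sk_zero] using (hs 0).isBigO_sub
  have g_O : (fun x => g x - 1) =O[𝓝 0] fun x => x ^ 2 :=
    isBigO_pow_succ_of_hasDerivAt (.of_forall fun x => (hg x).sub_const 1) (by simp [hg0])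
      (sk_O.const_mul_left _)
  have sk_O' : (fun x => sk κ x - x) =O[𝓝 0] fun x => x ^ 3 :=
    isBigO_pow_succ_of_hasDerivAt (.of_forall fun x => (hs x).sub (hasDerivAt_id x))
      (by simp [sk_zero]) g_O
  have g_O' : (fun x => g x - (1 - κ / 2 * x ^ 2)) =O[𝓝 0] fun x => x ^ 4 := by
    refine isBigO_pow_succ_of_hasDerivAt (f' := fun x => -κ * (sk κ x - x))
      (.of_forall fun x => ?_) (by simp [hg0]) (sk_O'.const_mul_left _)
    refine HasDerivAt.congr_deriv
      ((hg x).sub (((hasDerivAt_pow 2 x).const_mul (κ / 2)).const_sub 1)) ?_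
    push_cast
    ring
  refine (isBigO_pow_succ_of_hasDerivAt (.of_forall fun x => ?_) (by simp [sk_zero])
    g_O').trans (isBigO_pow_of_le (by norm_num))
  refine HasDerivAt.congr_deriv
    ((hs x).sub ((hasDerivAt_id x).sub ((hasDerivAt_pow 3 x).const_mul (κ / 6)))) ?_
  push_cast
  ring

open Topology in
/-- Composition of `𝔰_κ` with a third order expansion without constant term. -/
theorem sk_comp_sub_isBigO (κ a b d : ℝ) {F : ℝ → ℝ}
    (hF : (fun x => F x - (a * x + b * x ^ 2 + d * x ^ 3)) =O[𝓝 0] fun x => x ^ 4) :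
    (fun x => sk κ (F x) - (a * x + b * x ^ 2 + (d - κ / 6 * a ^ 3) * x ^ 3)) =O[𝓝 0]
      fun x => x ^ 4 := by
  have hF2 : (fun x => F x - a * x) =O[𝓝 0] fun x => x ^ 2 := by
    have := ((hF.trans (isBigO_pow_of_le (by norm_num : 2 ≤ 4))).add
      ((isBigO_refl (fun x : ℝ => x ^ 2) (𝓝 0)).const_mul_left b)).add
      ((isBigO_pow_of_le (by norm_num : 2 ≤ 3)).const_mul_left d)
    refine this.congr_left fun x => ?_
    ring
  have hlin : (fun x => a * x) =O[𝓝 0] fun x : ℝ => x :=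
    (isBigO_refl (fun x : ℝ => x) (𝓝 0)).const_mul_left a
  have hF1 : F =O[𝓝 0] fun x => x := by
    have := (hF2.trans (isBigO_pow_of_le (by norm_num : 1 ≤ 2))).add
      (hlin.congr_right fun x => (pow_one x).symm)
    simpa using this
  have hcube : (fun x => F x ^ 3 - (a * x) ^ 3) =O[𝓝 0] fun x => x ^ 4 := by
    have := hF2.mul (((hF1.mul hF1).add (hF1.mul hlin)).add (hlin.mul hlin))
    refine (this.congr_left fun x => ?_).congr_right fun x => ?_ <;> ring
  have hF0 : Tendsto F (𝓝 0) (𝓝 0) := hF1.trans_tendsto tendsto_id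
  have hsk := ((sk_sub_isBigO κ).comp_tendsto hF0).trans (hF1.pow 4)
  refine ((hsk.add hF).sub (hcube.const_mul_left (κ / 6))).congr_left fun x => ?_
  simp only [Function.comp_apply]
  ring

open Topology in
/-- Third order expansion of the primitive of a smooth function. -/
theorem integral_sub_isBigO {w : ℝ → ℝ} (hw : ContDiff ℝ 3 w) :
    (fun x => (∫ ξ in (0 : ℝ)..x, w ξ) - (w 0 * x + deriv w 0 / 2 * x ^ 2
      + deriv (deriv w) 0 / 6 * x ^ 3)) =O[𝓝 0] fun x => x ^ 4 := by
  have hw1 : ContDiff ℝ 2 (deriv w) := hw.deriv' (n := 2)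
  have hw2 : ContDiff ℝ 1 (deriv (deriv w)) := hw1.deriv' (n := 1)
  have h2 : (fun x => deriv (deriv w) x - deriv (deriv w) 0) =O[𝓝 0] fun x => x ^ 1 := by
    simpa using (hw2.differentiable (by norm_num) 0).isBigO_sub
  have h1 : (fun x => deriv w x - (deriv w 0 + deriv (deriv w) 0 * x)) =O[𝓝 0]
      fun x => x ^ 2 := by
    refine isBigO_pow_succ_of_hasDerivAt (.of_forall fun x => ?_) (by simp) h2
    refine HasDerivAt.congr_deriv ((hw1.differentiable (by norm_num) x).hasDerivAt.sub
      (((hasDerivAt_id x).const_mul (deriv (deriv w) 0)).const_add (deriv w 0))) ?_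
    ring
  have h0 : (fun x => w x - (w 0 + deriv w 0 * x + deriv (deriv w) 0 / 2 * x ^ 2)) =O[𝓝 0]
      fun x => x ^ 3 := by
    refine isBigO_pow_succ_of_hasDerivAt (.of_forall fun x => ?_) (by simp) h1
    refine HasDerivAt.congr_deriv ((hw.differentiable (by norm_num) x).hasDerivAt.sub
      ((((hasDerivAt_id x).const_mul (deriv w 0)).const_add (w 0)).add
        ((hasDerivAt_pow 2 x).const_mul (deriv (deriv w) 0 / 2)))) ?_
    push_cast
    ring
  refine isBigO_pow_succ_of_hasDerivAt (.of_forall fun x => ?_) (by simp) h0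
  refine HasDerivAt.congr_deriv ((hw.continuous.integral_hasStrictDerivAt 0 x).hasDerivAt.sub
    ((((hasDerivAt_id x).const_mul (w 0)).add
      ((hasDerivAt_pow 2 x).const_mul (deriv w 0 / 2))).add
        ((hasDerivAt_pow 3 x).const_mul (deriv (deriv w) 0 / 6)))) ?_
  push_cast
  ring

open Topology in
/-- Second order binomial expansion at `1`. -/
theorem one_add_rpow_sub_isBigO (p : ℝ) :
    (fun t : ℝ => (1 + t) ^ p - (1 + p * t + p * (p - 1) / 2 * t ^ 2)) =O[𝓝 0]
      fun t => t ^ 3 := by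
  have hpos : ∀ᶠ t : ℝ in 𝓝 0, 0 < 1 + t :=
    (eventually_gt_nhds (by norm_num : (-1 : ℝ) < 0)).mono fun t ht => by linarith
  have hderiv (q : ℝ) : ∀ t : ℝ, 0 < 1 + t →
      HasDerivAt (fun t : ℝ => (1 + t) ^ q) (q * (1 + t) ^ (q - 1)) t := fun t ht => by
    simpa using ((hasDerivAt_id t).const_add 1).rpow_const (p := q) (Or.inl ht.ne')
  have h2 : (fun t : ℝ => (1 + t) ^ (p - 2) - 1) =O[𝓝 0] fun t => t ^ 1 := by
    simpa using (hderiv (p - 2) 0 (by norm_num)).isBigO_sub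
  have h1 : (fun t : ℝ => (1 + t) ^ (p - 1) - (1 + (p - 1) * t)) =O[𝓝 0] fun t => t ^ 2 := by
    refine isBigO_pow_succ_of_hasDerivAt (hpos.mono fun t ht => ?_) (by simp)
      (h2.const_mul_left (p - 1))
    refine HasDerivAt.congr_deriv ((hderiv (p - 1) t ht).sub
      (((hasDerivAt_id t).const_mul (p - 1)).const_add 1)) ?_
    rw [show p - 1 - 1 = p - 2 by ring]
    ring
  refine isBigO_pow_succ_of_hasDerivAt (hpos.mono fun t ht => ?_) (by simp)
    (h1.const_mul_left p)
  refine HasDerivAt.congr_deriv ((hderiv p t ht).sub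
    ((((hasDerivAt_id t).const_mul p).const_add 1).add
    ((hasDerivAt_pow 2 t).const_mul (p * (p - 1) / 2)))) ?_
  push_cast
  ring

open Topology in
/-- Real powers of a function with a second order expansion around the value `1`. -/
theorem rpow_sub_isBigO (p u v : ℝ) {l : Filter ℝ} (hl : l ≤ 𝓝 0) {R : ℝ → ℝ}
    (hR : (fun x => R x - (1 + u * x + v * x ^ 2)) =O[l] fun x => x ^ 3) :
    (fun x => R x ^ p - (1 + p * u * x + (p * v + p * (p - 1) / 2 * u ^ 2) * x ^ 2)) =O[l]
      fun x => x ^ 3 := by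
  have hR2 : (fun x => R x - 1 - u * x) =O[l] fun x => x ^ 2 := by
    have := (hR.trans ((isBigO_pow_of_le (by norm_num : 2 ≤ 3)).mono hl)).add
      ((isBigO_refl (fun x : ℝ => x ^ 2) l).const_mul_left v)
    refine this.congr_left fun x => ?_
    ring
  have hlin : (fun x => u * x) =O[l] fun x : ℝ => x :=
    (isBigO_refl (fun x : ℝ => x) l).const_mul_left u
  have hR1 : (fun x => R x - 1) =O[l] fun x => x := by
    have := (hR2.trans ((isBigO_pow_of_le (by norm_num : 1 ≤ 2)).mono hl)).add
      (hlin.congr_right fun x => (pow_one x).symm)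
    simpa using this
  have hsq : (fun x => (R x - 1) ^ 2 - (u * x) ^ 2) =O[l] fun x => x ^ 3 := by
    refine ((hR2.mul (hR1.add hlin)).congr_left fun x => ?_).congr_right fun x => ?_ <;> ring
  have hR0 : Tendsto (fun x => R x - 1) l (𝓝 0) := hR1.trans_tendsto hl
  have hpow := ((one_add_rpow_sub_isBigO p).comp_tendsto hR0).trans (hR1.pow 3)
  refine ((hpow.add (hR.const_mul_left p)).add
    (hsq.const_mul_left (p * (p - 1) / 2))).congr_left fun x => ?_
  simp only [Function.comp_apply, add_sub_cancel]
  ring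

open Topology in
/-- Second order expansion of the quotient of two functions vanishing to first order. -/
theorem div_sub_isBigO {a b d e : ℝ} (ha : a ≠ 0) {f g : ℝ → ℝ}
    (hf : (fun x => f x - (a * x + b * x ^ 2 + d * x ^ 3)) =O[𝓝 0] fun x => x ^ 4)
    (hg : (fun x => g x - (a * x + 0 * x ^ 2 + e * x ^ 3)) =O[𝓝 0] fun x => x ^ 4) :
    (fun x => f x / g x - (1 + b / a * x + (d - e) / a * x ^ 2)) =O[𝓝[≠] 0]
      fun x => x ^ 3 := by
  have hgx : (fun x => g x - a * x) =o[𝓝 0] fun x => a * x := by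
    have := (hg.trans (isBigO_pow_of_le (by norm_num : 2 ≤ 4))).add
      ((isBigO_pow_of_le (by norm_num : 2 ≤ 3)).const_mul_left e)
    have h2 : (fun x => g x - a * x) =O[𝓝 0] fun x => x ^ 2 := by
      refine this.congr_left fun x => ?_
      ring
    refine (h2.trans_isLittleO (isLittleO_pow_pow one_lt_two)).trans_isBigO ?_
    simpa using (isBigO_refl (fun x : ℝ => x) (𝓝 0)).const_mul_right ha
  have hxg : (fun x => x) =O[𝓝 0] g := by
    have h : (fun x => a * x) =O[𝓝 0] g := by
      simpa using (IsEquivalent.isBigO_symm (u := g) hgx)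
    exact (isBigO_const_mul_left_iff ha).1 h
  have hxg' : (fun x => x) =O[𝓝[≠] 0] g := hxg.mono nhdsWithin_le_nhds
  have hinv : (fun x => (g x)⁻¹) =O[𝓝[≠] 0] fun x => x⁻¹ :=
    hxg'.inv_rev (eventually_mem_nhdsWithin.mono fun x hx h0 => (hx h0).elim)
  have hpoly : (fun x : ℝ => 1 + b / a * x + (d - e) / a * x ^ 2) =O[𝓝 0]
      fun _ => (1 : ℝ) :=
    (Continuous.tendsto (by fun_prop) 0).isBigO_one ℝ
  have hrest : (fun x : ℝ => b * e / a + (d - e) / a * e * x) =O[𝓝 0] fun _ => (1 : ℝ) :=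
    (Continuous.tendsto (by fun_prop) 0).isBigO_one ℝ
  have hnum : (fun x => f x - (1 + b / a * x + (d - e) / a * x ^ 2) * g x) =O[𝓝 0]
      fun x => x ^ 4 := by
    have h1 := hpoly.mul hg
    have h2 := hrest.mul (isBigO_refl (fun x : ℝ => x ^ 4) (𝓝 0))
    simp only [one_mul] at h1 h2
    refine ((hf.sub h1).sub h2).congr_left fun x => ?_
    field_simp
    ring
  have hg0 : ∀ᶠ x in 𝓝[≠] 0, g x ≠ 0 := by
    filter_upwards [hxg'.eq_zero_imp, eventually_mem_nhdsWithin] with x hx hx0 h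
    exact hx0 (hx h)
  refine ((hnum.mono nhdsWithin_le_nhds).mul hinv).congr' ?_ ?_
  · filter_upwards [hg0] with x hx
    field_simp
  · filter_upwards [eventually_mem_nhdsWithin] with x hx
    have : x ≠ 0 := hx
    field_simp

/-- Taylor expansion of the twisted coefficient from Appendix 6.2: for smooth positive
`w` and `c > 0`, as `δ → 0⁺`,
`(2𝔰_κ(∫₀^δ w)/𝔰_κ(∫_{−δ}^{δ} w))^{1/c}
  = 1 + (w'(0)/(2cw(0)))δ + (1/2)(κw(0)²/c + ((1−c)/c²)(w'(0)/(2w(0)))²)δ² + O(δ³)`. -/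
theorem stmt_10 (κ c : ℝ) (hc : 0 < c) (w : ℝ → ℝ) (hw : ContDiff ℝ (⊤ : ℕ∞) w)
    (hwpos : ∀ x, 0 < w x) :
    (fun δ : ℝ =>
        (2 * sk κ (∫ ξ in (0 : ℝ)..δ, w ξ) / sk κ (∫ ξ in (-δ)..δ, w ξ)) ^ (1 / c)
          - (1 + (deriv w 0 / (2 * c * w 0)) * δ
              + (1 / 2) * (κ * (w 0) ^ 2 / c
                  + ((1 - c) / c ^ 2) * (deriv w 0 / (2 * w 0)) ^ 2) * δ ^ 2))
      =O[nhdsWithin 0 (Ioi 0)] (fun δ : ℝ => δ ^ 3) := by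
  have hw3 : ContDiff ℝ 3 w := contDiff_infty.1 hw 3
  have ha : w 0 ≠ 0 := (hwpos 0).ne'
  have hF := integral_sub_isBigO hw3
  have hneg : Tendsto (fun x : ℝ => -x) (nhds 0) (nhds 0) := by
    simpa using (continuous_neg.tendsto (0 : ℝ))
  have hG : (fun x => (∫ ξ in (-x)..x, w ξ) - (2 * w 0 * x + 0 * x ^ 2
      + deriv (deriv w) 0 / 3 * x ^ 3)) =O[nhds 0] fun x => x ^ 4 := by
    have h := (hF.comp_tendsto hneg).congr_right (g₂ := fun x => x ^ 4) fun x => by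
      simp only [Function.comp_apply]
      ring
    refine (hF.sub h).congr_left fun x => ?_
    have hint (y z : ℝ) : IntervalIntegrable w MeasureTheory.volume y z :=
      hw3.continuous.intervalIntegrable y z
    rw [← integral_interval_sub_left (hint 0 x) (hint 0 (-x))]
    simp only [Function.comp_apply]
    ring
  have hnum := ((sk_comp_sub_isBigO κ _ _ _ hF).const_mul_left 2).congr_left
    (f₂ := fun x => 2 * sk κ (∫ ξ in (0 : ℝ)..x, w ξ) - (2 * w 0 * x + deriv w 0 * x ^ 2
      + 2 * (deriv (deriv w) 0 / 6 - κ / 6 * w 0 ^ 3) * x ^ 3)) fun x => by ring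
  have hR := (div_sub_isBigO (by simpa using ha) hnum (sk_comp_sub_isBigO κ _ _ _ hG)).mono
    (nhdsWithin_mono 0 fun x (hx : 0 < x) => hx.ne')
  refine (rpow_sub_isBigO (1 / c) _ _ nhdsWithin_le_nhds hR).congr_left fun x => ?_
  congr 1
  field_simp
  ring
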